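/- Let I be a finite interval, ξ a modulus on [0,|I|] (continuous, increasing, ξ(0)=0), and φ ∈ Ξ_ξ(I). Let φ* denote the decreasing rearrangement of φ on I. Then φ* ∈ Ξ_ξ(I) and ‖φ*‖_{Ξ_ξ(I)} ≤ ‖φ‖_{Ξ_ξ(I)}. -/

import Mathlib

open MeasureTheory

/-- The average of `f` over the interval `(a, b)`. -/
noncomputable def intervalAvg (f : ℝ → ℝ) (a b : ℝ) : ℝ :=
  (b - a)⁻¹ * ∫ x in a..b, f x

/-- The decreasing rearrangement of `φ` on the interval `I = (a,b)`:
`φ*(t) = inf{λ : |{s ∈ I : φ(s) > λ}| ≤ t − a}`. -/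
noncomputable def decRearrange (φ : ℝ → ℝ) (a b t : ℝ) : ℝ :=
  sInf {l : ℝ | (volume {s ∈ Set.Ioo a b | l < φ s}).toReal ≤ t - a}


/-- Integrals over an open set, component by component. -/
lemma rr_open_components (E : Set ℝ) (hE : IsOpen E) (a b : ℝ) (hEab : E ⊆ Set.Ioo a b)
    (f : ℝ → ℝ) (hf : IntegrableOn f E)
    (h : ∀ α β : ℝ, α < β → a ≤ α → β ≤ b → Set.Ioo α β ⊆ E → α ∉ E → β ∉ E →
      ∫ x in Set.Ioo α β, f x ≤ 0) :
    ∫ x in E, f x ≤ 0 := by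
  classical
  set S : Set (ℝ × ℝ) := {p | p.1 < p.2 ∧ a ≤ p.1 ∧ p.2 ≤ b ∧ Set.Ioo p.1 p.2 ⊆ E ∧
    p.1 ∉ E ∧ p.2 ∉ E} with hS
  have hdisj : S.PairwiseDisjoint (fun p => Set.Ioo p.1 p.2) := by
    intro p hp q hq hpq
    rw [Function.onFun, Set.disjoint_left]
    intro x hxp hxq
    apply hpq
    obtain ⟨p1, -, -, p2, p3, p4⟩ := hp
    obtain ⟨q1, -, -, q2, q3, q4⟩ := hq
    have e1 : p.1 = q.1 := by
      rcases lt_trichotomy p.1 q.1 with hh | hh | hh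
      · exact absurd (p2 ⟨hh, hxq.1.trans hxp.2⟩) q3
      · exact hh
      · exact absurd (q2 ⟨hh, hxp.1.trans hxq.2⟩) p3
    have e2 : p.2 = q.2 := by
      rcases lt_trichotomy p.2 q.2 with hh | hh | hh
      · exact absurd (q2 ⟨hxq.1.trans hxp.2, hh⟩) p4
      · exact hh
      · exact absurd (p2 ⟨hxp.1.trans hxq.2, hh⟩) q4
    exact Prod.ext e1 e2
  have hcount : S.Countable := hdisj.countable_of_isOpen (fun p _ => isOpen_Ioo)
    (fun p hp => Set.nonempty_Ioo.2 hp.1)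
  have hU : E = ⋃ p : S, Set.Ioo p.1.1 p.1.2 := by
    apply Set.Subset.antisymm
    · intro x hx
      have hxab := hEab hx
      have haE : a ∉ E := fun h => lt_irrefl _ (hEab h).1
      have hbE : b ∉ E := fun h => lt_irrefl _ (hEab h).2
      set A := Eᶜ ∩ Set.Icc a x
      set B := Eᶜ ∩ Set.Icc x b
      have hAc : IsCompact A := isCompact_Icc.inter_left hE.isClosed_compl
      have hBc : IsCompact B := isCompact_Icc.inter_left hE.isClosed_compl
      have hA := hAc.sSup_mem ⟨a, haE, le_refl _, hxab.1.le⟩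
      have hB := hBc.sInf_mem ⟨b, hbE, hxab.2.le, le_refl _⟩
      have hAx : sSup A < x := lt_of_le_of_ne hA.2.2 (fun h => hA.1 (h ▸ hx))
      have hBx : x < sInf B := lt_of_le_of_ne hB.2.1 (fun h => hB.1 (h ▸ hx))
      rw [Set.mem_iUnion]
      refine ⟨⟨(sSup A, sInf B), hAx.trans hBx, hA.2.1, hB.2.2, ?_, hA.1, hB.1⟩, hAx, hBx⟩
      intro y hy
      by_contra hyE
      rcases le_total y x with hyx | hyx
      · exact absurd (le_csSup hAc.bddAbove ⟨hyE, hA.2.1.trans hy.1.le, hyx⟩) (not_le.2 hy.1)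
      · exact absurd (csInf_le hBc.bddBelow ⟨hyE, hyx, hy.2.le.trans hB.2.2⟩) (not_le.2 hy.2)
    · exact Set.iUnion_subset fun p => p.2.2.2.2.1
  have : Countable S := hcount.to_subtype
  rw [hU] at hf
  rw [hU, integral_iUnion (ι := S) (fun p => measurableSet_Ioo)
    (fun p q hpq => hdisj p.2 q.2 (fun h => hpq (Subtype.ext h))) hf]
  exact tsum_nonpos fun p => h _ _ p.2.1 p.2.2.1 p.2.2.2.1 p.2.2.2.2.1 p.2.2.2.2.2.1
    p.2.2.2.2.2.2

/-- Covering lemma when all windows of length `h` have averages of the same sign. -/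
lemma rr_cover_aux (a b h V : ℝ) (hab : a < b) (hh : 0 < h)
    (ψ : ℝ → ℝ) (hψ : Integrable ψ) (hψ2 : Integrable (fun x => ψ x ^ 2))
    (hD : ∀ x y, a ≤ x → x + h ≤ b → a ≤ y → y + h ≤ b →
      0 < (∫ s in x..(x+h), ψ s) * (∫ s in y..(y+h), ψ s))
    (hV : ∀ c d, a ≤ c → c < d → d ≤ b → d - c ≤ h → ∫ s in c..d, ψ s = 0 →
      ∫ s in c..d, ψ s ^ 2 ≤ V * (d - c))
    (hb : ∫ s in a..b, ψ s ≤ 0) :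
    ∃ E : Set ℝ, MeasurableSet E ∧ E ⊆ Set.Ioo a b ∧ ∫ x in E, ψ x = 0 ∧
      ∫ x in E, (ψ x ^ 2 - V) ≤ 0 ∧ ∀ᵐ x, x ∈ Set.Ioo a b → x ∉ E → ψ x ≤ 0 := by
  set F : ℝ → ℝ := fun x => ∫ s in a..x, ψ s with hF
  have hii : ∀ c d, IntervalIntegrable ψ volume c d := fun c d => hψ.intervalIntegrable
  have hFc : Continuous F := intervalIntegral.continuous_primitive hii a
  have hFa : F a = 0 := by simp [hF]
  have hFd : ∀ c d, ∫ s in c..d, ψ s = F d - F c := fun c d =>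
    (intervalIntegral.integral_interval_sub_left (hii _ _) (hii _ _)).symm
  have hFb : F b ≤ 0 := hb
  set E : Set ℝ := {x | x ∈ Set.Ioo a b ∧ (0 < F x ∨ ∃ y, y ≤ b ∧ x < y ∧ F x < min (F y) 0)}
    with hE
  have hEab : E ⊆ Set.Ioo a b := fun x hx => hx.1
  have hEo : IsOpen E := by
    have : E = Set.Ioo a b ∩ ({x | 0 < F x} ∪ ⋃ y ∈ Set.Iic b, (Set.Iio y ∩
        {x | F x < min (F y) 0})) := by
      ext x
      simp only [hE, Set.mem_ofPred_eq, Set.mem_inter_iff, Set.mem_union, Set.mem_iUnion,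
        Set.mem_Iic, Set.mem_Iio, exists_prop]
    rw [this]
    refine isOpen_Ioo.inter ((isOpen_lt continuous_const hFc).union ?_)
    exact isOpen_biUnion fun y _ => isOpen_Iio.inter (isOpen_lt hFc continuous_const)
  have hP : ∀ z, a ≤ z → z ≤ b → z ∉ E → F z ≤ 0 ∧ ∀ y, z ≤ y → y ≤ b → min (F y) 0 ≤ F z := by
    intro z haz hzb hzE
    rcases haz.eq_or_lt with rfl | haz
    · rw [hFa]
      exact ⟨le_rfl, fun y _ _ => min_le_right _ _⟩
    rcases hzb.eq_or_lt with rfl | hzb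
    · refine ⟨hFb, fun y h1 h2 => ?_⟩
      rw [le_antisymm h2 h1]
      exact min_le_left _ _
    have h1 : ¬ (0 < F z ∨ ∃ y, y ≤ b ∧ z < y ∧ F z < min (F y) 0) := fun hn => hzE ⟨⟨haz, hzb⟩, hn⟩
    push Not at h1
    refine ⟨h1.1, fun y hy1 hy2 => ?_⟩
    rcases hy1.eq_or_lt with rfl | hy1
    · exact min_le_left _ _
    · exact h1.2 y hy2 hy1
  -- structure of components
  have hcomp : ∀ α β : ℝ, α < β → a ≤ α → β ≤ b → Set.Ioo α β ⊆ E → α ∉ E → β ∉ E →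
      F α = F β ∧ β - α ≤ h := by
    intro α β hαβ haα hβb hsub hαE hβE
    obtain ⟨hα0, hα⟩ := hP α haα (hαβ.le.trans hβb) hαE
    obtain ⟨hβ0, hβ⟩ := hP β (haα.trans hαβ.le) hβb hβE
    have hle : F β ≤ F α := by
      have := hα β hαβ.le hβb
      rwa [min_eq_left hβ0] at this
    have heq : F α = F β := by
      by_contra hne
      have hlt : F β < F α := lt_of_le_of_ne hle (Ne.symm hne)
      obtain ⟨μ, hμ1, hμ2⟩ := exists_between hlt
      set T := {x | μ ≤ F x} ∩ Set.Icc α β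
      have hTc : IsCompact T := isCompact_Icc.inter_left (isClosed_le continuous_const hFc)
      have hT := hTc.sSup_mem ⟨α, hμ2.le, le_refl _, hαβ.le⟩
      set z := sSup T
      obtain ⟨w, hw, hwμ⟩ : μ ∈ F '' Set.Icc z β :=
        intermediate_value_Icc' hT.2.2 hFc.continuousOn ⟨hμ1.le, hT.1⟩
      have hwz : w = z := le_antisymm
        (le_csSup hTc.bddAbove ⟨hwμ.ge, hT.2.1.trans hw.1, hw.2⟩) hw.1
      rw [hwz] at hwμ
      have hz1 : α < z := lt_of_le_of_ne hT.2.1 (fun e => by rw [← e] at hwμ; linarith)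
      have hz2 : z < β := lt_of_le_of_ne hT.2.2 (fun e => by rw [e] at hwμ; linarith)
      rcases (hsub ⟨hz1, hz2⟩).2 with h1 | ⟨y, hyb, hzy, hy⟩
      · linarith
      · rcases le_total y β with hyβ | hyβ
        · have : y ≤ z := le_csSup hTc.bddAbove
            ⟨by have := min_le_left (F y) 0; simp only [Set.mem_ofPred_eq]; linarith,
              hz1.le.trans hzy.le, hyβ⟩
          linarith
        · have := hβ y hyβ hyb
          linarith
    refine ⟨heq, ?_⟩
    by_contra hlong
    push Not at hlong
    have hpos := hD α (β - h) haα (by linarith) (by linarith) (by linarith)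
    rw [hFd, hFd, sub_add_cancel, ← heq] at hpos
    have hm1 : α + h ∈ Set.Ioo α β := ⟨by linarith, by linarith⟩
    have hm2 : β - h ∈ Set.Ioo α β := ⟨by linarith, by linarith⟩
    rcases hα0.lt_or_eq with hneg | hzero
    · have key : ∀ x ∈ Set.Ioo α β, F x ≤ F α := by
        intro x hx
        have := hα x hx.1.le (hx.2.le.trans hβb)
        rcases min_le_iff.1 this with h1 | h1
        · exact h1
        · linarith
      nlinarith [key _ hm1, key _ hm2]
    · have key : ∀ x ∈ Set.Ioo α β, F x ≠ 0 := by
        intro x hx h0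
        rcases (hsub hx).2 with h1 | ⟨y, -, -, hy⟩
        · linarith
        · have := min_le_right (F y) 0
          linarith
      rw [hzero] at hpos
      have h0 : (0:ℝ) ∈ Set.uIcc (F (α + h)) (F (β - h)) := by
        rw [Set.mem_uIcc]
        by_contra hcon
        push Not at hcon
        rcases lt_or_ge (F (α + h)) 0 with h1 | h1
        · nlinarith [hcon.1 h1.le]
        · rcases le_or_gt (F (β - h)) 0 with h2 | h2
          · nlinarith [hcon.2 h2]
          · nlinarith
      obtain ⟨w, hw, hw0⟩ := intermediate_value_uIcc hFc.continuousOn h0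
      exact key w (Set.ordConnected_Ioo.uIcc_subset hm1 hm2 hw) hw0
  have hfin : volume E ≠ ⊤ := ((measure_mono hEab).trans_lt (by simp)).ne
  have hIoo : ∀ (f : ℝ → ℝ) (α β : ℝ), α < β → ∫ x in Set.Ioo α β, f x = ∫ x in α..β, f x :=
    fun f α β hαβ => by rw [intervalIntegral.integral_of_le hαβ.le, integral_Ioc_eq_integral_Ioo]
  refine ⟨E, hEo.measurableSet, hEab, le_antisymm ?_ ?_, ?_, ?_⟩
  · refine rr_open_components E hEo a b hEab ψ hψ.integrableOn ?_
    intro α β h1 h2 h3 h4 h5 h6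
    rw [hIoo _ _ _ h1, hFd, (hcomp α β h1 h2 h3 h4 h5 h6).1, sub_self]
  · have := rr_open_components E hEo a b hEab (fun x => - ψ x) hψ.neg.integrableOn ?_
    · rw [integral_neg] at this
      linarith
    intro α β h1 h2 h3 h4 h5 h6
    rw [integral_neg, hIoo _ _ _ h1, hFd, (hcomp α β h1 h2 h3 h4 h5 h6).1, sub_self, neg_zero]
  · refine rr_open_components E hEo a b hEab _
      (hψ2.integrableOn.sub (integrableOn_const hfin)) ?_
    intro α β h1 h2 h3 h4 h5 h6
    obtain ⟨h7, h8⟩ := hcomp α β h1 h2 h3 h4 h5 h6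
    have := hV α β h2 h1 h3 h8 (by rw [hFd, h7, sub_self])
    rw [hIoo _ _ _ h1, intervalIntegral.integral_sub hψ2.intervalIntegrable (by simp)]
    simp only [intervalIntegral.integral_const, smul_eq_mul]
    linarith
  · have hcnt := (countable_setOfPred_isolated_right_within (s := {x | F x = 0})).ae_notMem volume
    filter_upwards [LocallyIntegrable.ae_hasDerivAt_integral hψ.locallyIntegrable, hcnt]
      with x hx hxc hxab hxE
    by_contra hpos
    push Not at hpos
    obtain ⟨h0, hx2⟩ := hP x hxab.1.le hxab.2.le hxE
    have hder := hx a
    have hev : ∀ᶠ y in nhdsWithin x (Set.Ioi x), F x < F y := by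
      have := (hasDerivAt_iff_tendsto_slope.1 hder).mono_left
        (nhdsWithin_mono x (fun y (hy : y ∈ Set.Ioi x) => ne_of_gt hy))
      filter_upwards [this.eventually (lt_mem_nhds hpos), self_mem_nhdsWithin] with y hy hxy
      rw [slope_def_field] at hy
      have hxy' : 0 < y - x := sub_pos.2 hxy
      have := (div_pos_iff_of_pos_right hxy').1 hy
      change 0 < F y - F x at this
      linarith
    have hev2 : ∀ᶠ y in nhdsWithin x (Set.Ioi x), F x < F y ∧ y ≤ b ∧ x < y := by
      filter_upwards [hev, self_mem_nhdsWithin,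
        mem_nhdsWithin_of_mem_nhds (Iic_mem_nhds hxab.2)] with y h1 h2 h3 using ⟨h1, h3, h2⟩
    obtain ⟨u, hu, hu2⟩ := (mem_nhdsGT_iff_exists_Ioo_subset).1 hev2
    have hFx : F x = 0 := by
      obtain ⟨y, hy⟩ := exists_between (show x < u from hu)
      obtain ⟨h1, h2, h3⟩ := hu2 hy
      rcases min_le_iff.1 (hx2 y h3.le h2) with h4 | h4
      · linarith
      · linarith
    apply hxc
    refine ⟨hFx, ?_⟩
    rw [← Filter.empty_mem_iff_bot]
    filter_upwards [hev.filter_mono (nhdsWithin_mono x Set.inter_subset_right),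
      self_mem_nhdsWithin] with y hy1 hy2
    rw [hFx, show F y = 0 from hy2.1] at hy1
    exact lt_irrefl _ hy1
/-- The covering lemma. -/
lemma rr_cover (a b h V : ℝ) (hab : a < b) (hh : 0 < h)
    (ψ : ℝ → ℝ) (hψ : Integrable ψ) (hψ2 : Integrable (fun x => ψ x ^ 2))
    (hV : ∀ c d, a ≤ c → c < d → d ≤ b → d - c ≤ h → ∫ s in c..d, ψ s = 0 →
      ∫ s in c..d, ψ s ^ 2 ≤ V * (d - c)) :
    ∃ E : Set ℝ, MeasurableSet E ∧ E ⊆ Set.Ioo a b ∧ ∫ x in E, ψ x = 0 ∧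
      ∫ x in E, (ψ x ^ 2 - V) ≤ 0 ∧ (h ≤ volume.real E ∨
        (∀ᵐ x, x ∈ Set.Ioo a b → x ∉ E → ψ x ≤ 0) ∨
        (∀ᵐ x, x ∈ Set.Ioo a b → x ∉ E → 0 ≤ ψ x)) := by
  have hIoo : ∀ (f : ℝ → ℝ) (α β : ℝ), α < β → ∫ x in Set.Ioo α β, f x = ∫ x in α..β, f x :=
    fun f α β hαβ => by rw [intervalIntegral.integral_of_le hαβ.le, integral_Ioc_eq_integral_Ioo]
  by_cases hex : ∃ x, a ≤ x ∧ x + h ≤ b ∧ ∫ s in x..(x+h), ψ s = 0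
  · obtain ⟨x, hx1, hx2, hx3⟩ := hex
    refine ⟨Set.Ioo x (x + h), measurableSet_Ioo, Set.Ioo_subset_Ioo hx1 hx2, ?_, ?_, Or.inl ?_⟩
    · rw [hIoo _ _ _ (by linarith), hx3]
    · rw [hIoo _ _ _ (by linarith), intervalIntegral.integral_sub hψ2.intervalIntegrable (by simp)]
      simp only [intervalIntegral.integral_const, smul_eq_mul]
      have := hV x (x + h) hx1 (by linarith) hx2 (by linarith) hx3
      linarith
    · simp [hh.le]
  · push Not at hex
    have hii : ∀ c d, IntervalIntegrable ψ volume c d := fun c d => hψ.intervalIntegrable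
    set D : ℝ → ℝ := fun x => ∫ s in x..(x+h), ψ s with hDdef
    have hDc : Continuous D := by
      have hFc : Continuous (fun x => ∫ s in a..x, ψ s) :=
        intervalIntegral.continuous_primitive hii a
      have : D = fun x => (∫ s in a..(x+h), ψ s) - ∫ s in a..x, ψ s := by
        ext x
        exact (intervalIntegral.integral_interval_sub_left (hii _ _) (hii _ _)).symm
      rw [this]
      exact (hFc.comp (continuous_id.add continuous_const)).sub hFc
    have hD : ∀ x y, a ≤ x → x + h ≤ b → a ≤ y → y + h ≤ b → 0 < D x * D y := by
      intro x y hx1 hx2 hy1 hy2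
      by_contra hneg
      push Not at hneg
      have h0 : (0:ℝ) ∈ Set.uIcc (D x) (D y) := by
        rw [Set.mem_uIcc]
        have n1 := hex x hx1 hx2
        change D x ≠ 0 at n1
        rcases lt_or_gt_of_ne n1 with h1 | h1
        · exact Or.inl ⟨h1.le, by nlinarith⟩
        · exact Or.inr ⟨by nlinarith, h1.le⟩
      obtain ⟨w, hw, hw0⟩ := intermediate_value_uIcc hDc.continuousOn h0
      have hw' : w ∈ Set.Icc a (b - h) := Set.ordConnected_Icc.uIcc_subset
        ⟨hx1, by linarith⟩ ⟨hy1, by linarith⟩ hw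
      exact hex w hw'.1 (by linarith [hw'.2]) hw0
    rcases le_total (∫ s in a..b, ψ s) 0 with hb | hb
    · obtain ⟨E, h1, h2, h3, h4, h5⟩ := rr_cover_aux a b h V hab hh ψ hψ hψ2 hD hV hb
      exact ⟨E, h1, h2, h3, h4, Or.inr (Or.inl h5)⟩
    · obtain ⟨E, h1, h2, h3, h4, h5⟩ := rr_cover_aux a b h V hab hh (fun x => - ψ x) hψ.neg
        (by simpa using hψ2) (by simpa using hD) (by simpa using hV) (by simpa using hb)
      refine ⟨E, h1, h2, by simpa [integral_neg] using h3, by simpa using h4, Or.inr (Or.inr ?_)⟩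
      simpa using h5

/-- The comparison lemma. -/
lemma rr_compare (a b h p s m M V V' : ℝ) (hab : a < b) (hh : 0 < h) (hp : 0 ≤ p) (hs : 0 ≤ s)
    (hsum : b - a = h + p + s) (hm : m ≤ 0) (hM : 0 ≤ M) (hV' : 0 ≤ V')
    (ψ : ℝ → ℝ) (hψ : Integrable ψ) (hψ2 : Integrable (fun x => ψ x ^ 2))
    (hb : ∀ x ∈ Set.Ioo a b, m ≤ ψ x ∧ ψ x ≤ M)
    (h1 : ∫ x in Set.Ioo a b, ψ x = p * M + s * m)
    (h2 : ∫ x in Set.Ioo a b, ψ x ^ 2 = V * h + p * M ^ 2 + s * m ^ 2)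
    (E : Set ℝ) (hE : MeasurableSet E) (hEab : E ⊆ Set.Ioo a b) (hE1 : ∫ x in E, ψ x = 0)
    (hE2 : ∫ x in E, (ψ x ^ 2 - V') ≤ 0)
    (hE3 : h ≤ volume.real E ∨
        (∀ᵐ x, x ∈ Set.Ioo a b → x ∉ E → ψ x ≤ 0) ∨
        (∀ᵐ x, x ∈ Set.Ioo a b → x ∉ E → 0 ≤ ψ x)) : V ≤ V' := by
  have gen : ∀ (X : Set ℝ), X ⊆ Set.Ioo a b → ∀ A B D : ℝ,
      ∫ x in X, (A * ψ x ^ 2 + B * ψ x + D) =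
        A * (∫ x in X, ψ x ^ 2) + B * (∫ x in X, ψ x) + D * volume.real X := by
    intro X hX A B D
    have hfin : volume X ≠ ⊤ := ((measure_mono hX).trans_lt (by simp)).ne
    have i1 : IntegrableOn (fun x => A * ψ x ^ 2) X := hψ2.integrableOn.const_mul A
    have i2 : IntegrableOn (fun x => B * ψ x) X := hψ.integrableOn.const_mul B
    have i12 : IntegrableOn (fun x => A * ψ x ^ 2 + B * ψ x) X := i1.add i2
    have i3 : IntegrableOn (fun x => D) X := integrableOn_const hfin
    rw [integral_add i12 i3, integral_add i1 i2, integral_const_mul, integral_const_mul,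
      setIntegral_const, smul_eq_mul, mul_comm D]
  set X := Set.Ioo a b \ E with hX
  have hXm : MeasurableSet X := measurableSet_Ioo.diff hE
  have hXab : X ⊆ Set.Ioo a b := Set.sdiff_subset
  have hX1 : ∫ x in X, ψ x = p * M + s * m := by
    rw [hX, setIntegral_sdiff hE hψ.integrableOn hEab, h1, hE1, sub_zero]
  set P := ∫ x in E, ψ x ^ 2 with hP
  have hX2 : ∫ x in X, ψ x ^ 2 = V * h + p * M ^ 2 + s * m ^ 2 - P := by
    rw [hX, setIntegral_sdiff hE hψ2.integrableOn hEab, h2]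
  set e := volume.real E with he
  have he0 : 0 ≤ e := measureReal_nonneg
  have hI : volume.real (Set.Ioo a b) = h + p + s := by
    rw [Real.volume_real_Ioo_of_le hab.le, hsum]
  have hX3 : volume.real X = h + p + s - e := by
    rw [hX, measureReal_sdiff hEab hE (by simp), hI]
  have hPe : P ≤ V' * e := by
    have := gen E hEab 1 0 (-V')
    simp only [one_mul, zero_mul, add_zero, ← sub_eq_add_neg] at this
    rw [this] at hE2
    linarith
  have nn : ∀ (Y : Set ℝ), MeasurableSet Y → Y ⊆ Set.Ioo a b → ∀ A B D : ℝ,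
      (∀ᵐ x, x ∈ Y → 0 ≤ A * ψ x ^ 2 + B * ψ x + D) →
      0 ≤ A * (∫ x in Y, ψ x ^ 2) + B * (∫ x in Y, ψ x) + D * volume.real Y := by
    intro Y hYm hY A B D hpos
    rw [← gen Y hY]
    exact setIntegral_nonneg_of_ae_restrict ((ae_restrict_iff' hYm).2 hpos)
  have hVm : V ≤ - m * M := by
    have := nn _ measurableSet_Ioo subset_rfl (-1) (m + M) (-m * M) (ae_of_all _ fun x hx => by
      nlinarith [mul_nonneg (sub_nonneg.2 (hb x hx).1) (sub_nonneg.2 (hb x hx).2)])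
    rw [h1, h2, hI] at this
    by_contra hcon
    push Not at hcon
    nlinarith
  have fin : V * h - m * M * (e - h) ≤ P → h ≤ e → V ≤ V' := by
    intro f1 f2
    by_contra hcon
    push Not at hcon
    nlinarith
  have fin2 : V * h ≤ P → e ≤ h → V ≤ V' := by
    intro f1 f2
    by_contra hcon
    push Not at hcon
    nlinarith
  rcases hE3 with hc | hc | hc
  · refine fin ?_ hc
    have := nn X hXm hXab (-1) (m + M) (-m * M) (ae_of_all _ fun x hx => by
      nlinarith [mul_nonneg (sub_nonneg.2 (hb x hx.1).1) (sub_nonneg.2 (hb x hx.1).2)])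
    rw [hX1, hX2, hX3] at this
    linarith
  · have k1 := nn X hXm hXab (-1) m 0 (by
      filter_upwards [hc] with x hx hxX
      nlinarith [mul_nonneg (neg_nonneg.2 (hx hxX.1 hxX.2)) (sub_nonneg.2 (hb x hxX.1).1)])
    have k2 := nn X hXm hXab 0 1 (-m) (ae_of_all _ fun x hx => by linarith [(hb x hx.1).1])
    rw [hX1, hX2, hX3] at k1 k2
    have k3 : 0 ≤ p * M * (M - m) := by
      have : 0 ≤ M - m := by linarith
      positivity
    rcases le_total h e with hhe | hhe
    · refine fin ?_ hhe
      nlinarith [mul_nonneg hM k2]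
    · refine fin2 ?_ hhe
      linarith
  · have k1 := nn X hXm hXab (-1) M 0 (by
      filter_upwards [hc] with x hx hxX
      nlinarith [mul_nonneg (hx hxX.1 hxX.2) (sub_nonneg.2 (hb x hxX.1).2)])
    have k2 := nn X hXm hXab 0 (-1) M (ae_of_all _ fun x hx => by linarith [(hb x hx.1).2])
    rw [hX1, hX2, hX3] at k1 k2
    have k3 : 0 ≤ s * (-m) * (M - m) := by
      have : 0 ≤ M - m := by linarith
      have : 0 ≤ -m := by linarith
      positivity
    rcases le_total h e with hhe | hhe
    · refine fin ?_ hhe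
      nlinarith [mul_nonneg (neg_nonneg.2 hm) k2]
    · refine fin2 ?_ hhe
      linarith
lemma rr_dist (a b : ℝ) (φ : ℝ → ℝ)
    (hφ : AEMeasurable φ (volume.restrict (Set.Ioo a b))) (l : ℝ) :
    volume {s ∈ Set.Ioo a b | l < φ s} =
      Measure.map φ (volume.restrict (Set.Ioo a b)) (Set.Ioi l) := by
  rw [Measure.map_apply_of_aemeasurable hφ measurableSet_Ioi,
    Measure.restrict_apply' measurableSet_Ioo]
  congr 1
  ext s
  simp only [Set.mem_inter_iff, Set.mem_preimage, Set.mem_Ioi]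
  exact and_comm

lemma rr_le_iff (a b : ℝ) (hab : a < b) (φ : ℝ → ℝ)
    (hφ : AEMeasurable φ (volume.restrict (Set.Ioo a b))) (t : ℝ) (ht : t ∈ Set.Ioo a b) (l : ℝ) :
    decRearrange φ a b t ≤ l ↔
      (Measure.map φ (volume.restrict (Set.Ioo a b)) (Set.Ioi l)).toReal ≤ t - a := by
  set μ := Measure.map φ (volume.restrict (Set.Ioo a b)) with hμ
  have hfin : IsFiniteMeasure (volume.restrict (Set.Ioo a b)) := by
    constructor
    simp
  have hfin2 : IsFiniteMeasure μ := Measure.isFiniteMeasure_map _ _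
  have huniv : μ Set.univ = ENNReal.ofReal (b - a) := by
    rw [hμ, Measure.map_apply_of_aemeasurable hφ MeasurableSet.univ]
    simp
  set S : Set ℝ := {l : ℝ | (μ (Set.Ioi l)).toReal ≤ t - a} with hS
  have hdef : decRearrange φ a b t = sInf S := by
    simp only [decRearrange, rr_dist a b φ hφ]
    rfl
  have hanti : ∀ x y, x ≤ y → (μ (Set.Ioi y)).toReal ≤ (μ (Set.Ioi x)).toReal := fun x y hxy =>
    ENNReal.toReal_mono (measure_ne_top _ _) (measure_mono (Set.Ioi_subset_Ioi hxy))
  have hne : S.Nonempty := by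
    have h1 := tendsto_measure_Iic_atTop μ
    have h2 : ENNReal.ofReal (b - t) < μ Set.univ := by
      rw [huniv]
      exact (ENNReal.ofReal_lt_ofReal_iff (by linarith)).2 (by linarith [ht.1])
    obtain ⟨l, hl⟩ := (h1.eventually (lt_mem_nhds h2)).exists
    refine ⟨l, ?_⟩
    have h3 : μ (Set.Iic l) + μ (Set.Ioi l) = μ Set.univ := by
      rw [← Set.compl_Iic]
      exact measure_add_measure_compl measurableSet_Iic
    have h4 := congrArg ENNReal.toReal h3
    rw [ENNReal.toReal_add (measure_ne_top _ _) (measure_ne_top _ _), huniv,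
      ENNReal.toReal_ofReal (by linarith)] at h4
    have h5 : b - t < (μ (Set.Iic l)).toReal :=
      (ENNReal.ofReal_lt_iff_lt_toReal (by linarith [ht.2]) (measure_ne_top _ _)).1 hl
    change (μ (Set.Ioi l)).toReal ≤ t - a
    linarith
  have hbdd : BddBelow S := by
    have h1 := tendsto_measure_Ici_atBot μ
    have h2 : ENNReal.ofReal (t - a) < μ Set.univ := by
      rw [huniv]
      exact (ENNReal.ofReal_lt_ofReal_iff (by linarith)).2 (by linarith [ht.2])
    obtain ⟨l, hl⟩ := (h1.eventually (lt_mem_nhds h2)).exists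
    refine ⟨l - 1, fun y hy => ?_⟩
    by_contra hcon
    push Not at hcon
    have h5 : t - a < (μ (Set.Ici l)).toReal :=
      (ENNReal.ofReal_lt_iff_lt_toReal (by linarith [ht.1]) (measure_ne_top _ _)).1 hl
    have h6 : (μ (Set.Ici l)).toReal ≤ (μ (Set.Ioi y)).toReal :=
      ENNReal.toReal_mono (measure_ne_top _ _) (measure_mono (Set.Ici_subset_Ioi.2 (by linarith)))
    have h7 : (μ (Set.Ioi y)).toReal ≤ t - a := hy
    linarith
  rw [hdef]
  constructor
  · intro hl
    have hgt : ∀ y, l < y → (μ (Set.Ioi y)).toReal ≤ t - a := by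
      intro y hy
      obtain ⟨z, hz, hzy⟩ := exists_lt_of_csInf_lt hne (hl.trans_lt hy)
      exact (hanti z y hzy.le).trans hz
    have hU : Set.Ioi l = ⋃ n : ℕ, Set.Ioi (l + 1 / ((n : ℝ) + 1)) := by
      ext x
      simp only [Set.mem_Ioi, Set.mem_iUnion]
      constructor
      · intro hx
        obtain ⟨n, hn⟩ := exists_nat_one_div_lt (sub_pos.2 hx)
        exact ⟨n, by linarith⟩
      · rintro ⟨n, hn⟩
        have : 0 < 1 / ((n : ℝ) + 1) := by positivity
        linarith
    have hmono : Monotone (fun n : ℕ => Set.Ioi (l + 1 / ((n : ℝ) + 1))) := by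
      intro n k hnk
      apply Set.Ioi_subset_Ioi
      have := Nat.one_div_le_one_div (α := ℝ) hnk
      linarith
    apply ENNReal.toReal_le_of_le_ofReal (by linarith [ht.1])
    rw [hU, hmono.measure_iUnion]
    refine iSup_le fun n => ?_
    rw [ENNReal.le_ofReal_iff_toReal_le (measure_ne_top _ _) (by linarith [ht.1])]
    apply hgt
    have : 0 < 1 / ((n : ℝ) + 1) := by positivity
    linarith
  · intro hl
    exact csInf_le hbdd hl

lemma rr_anti (a b : ℝ) (hab : a < b) (φ : ℝ → ℝ)
    (hφ : AEMeasurable φ (volume.restrict (Set.Ioo a b))) :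
    AntitoneOn (decRearrange φ a b) (Set.Ioo a b) := by
  intro x hx y hy hxy
  rw [rr_le_iff a b hab φ hφ y hy]
  have := (rr_le_iff a b hab φ hφ x hx _).1 le_rfl
  linarith

lemma rr_map (a b : ℝ) (hab : a < b) (φ : ℝ → ℝ)
    (hφ : AEMeasurable φ (volume.restrict (Set.Ioo a b))) :
    Measure.map (decRearrange φ a b) (volume.restrict (Set.Ioo a b)) =
      Measure.map φ (volume.restrict (Set.Ioo a b)) := by
  have hg : AEMeasurable (decRearrange φ a b) (volume.restrict (Set.Ioo a b)) :=
    aemeasurable_restrict_of_antitoneOn measurableSet_Ioo (rr_anti a b hab φ hφ)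
  have hfin : IsFiniteMeasure (volume.restrict (Set.Ioo a b)) := by
    constructor
    simp
  have h1 : IsFiniteMeasure (Measure.map φ (volume.restrict (Set.Ioo a b))) :=
    Measure.isFiniteMeasure_map _ _
  have h2 : IsFiniteMeasure (Measure.map (decRearrange φ a b) (volume.restrict (Set.Ioo a b))) :=
    Measure.isFiniteMeasure_map _ _
  have huniv : Measure.map (decRearrange φ a b) (volume.restrict (Set.Ioo a b)) Set.univ =
      Measure.map φ (volume.restrict (Set.Ioo a b)) Set.univ := by
    rw [Measure.map_apply_of_aemeasurable hφ MeasurableSet.univ,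
      Measure.map_apply_of_aemeasurable hg MeasurableSet.univ]
    simp
  have hIoi : ∀ l, Measure.map (decRearrange φ a b) (volume.restrict (Set.Ioo a b)) (Set.Ioi l) =
      Measure.map φ (volume.restrict (Set.Ioo a b)) (Set.Ioi l) := by
    intro l
    rw [← rr_dist a b _ hg]
    set N := Measure.map φ (volume.restrict (Set.Ioo a b)) (Set.Ioi l) with hN
    have hNtop : N ≠ ⊤ := measure_ne_top _ _
    have hNle : N.toReal ≤ b - a := by
      have : N ≤ ENNReal.ofReal (b - a) := by
        rw [hN, ← rr_dist a b _ hφ, ← Real.volume_Ioo]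
        exact measure_mono fun s hs => hs.1
      exact ENNReal.toReal_le_of_le_ofReal (by linarith) this
    have : {s ∈ Set.Ioo a b | l < decRearrange φ a b s} = Set.Ioo a (a + N.toReal) := by
      ext s
      constructor
      · rintro ⟨hs, hl⟩
        rw [← not_le, rr_le_iff a b hab φ hφ s hs, not_le] at hl
        exact ⟨hs.1, by linarith⟩
      · rintro ⟨hs1, hs2⟩
        have hs : s ∈ Set.Ioo a b := ⟨hs1, by linarith⟩
        refine ⟨hs, ?_⟩
        rw [← not_le, rr_le_iff a b hab φ hφ s hs, not_le]
        linarith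
    rw [this, Real.volume_Ioo, add_sub_cancel_left, ENNReal.ofReal_toReal hNtop]
  refine Measure.ext_of_Iic _ _ fun l => ?_
  rw [← Set.compl_Ioi, measure_compl measurableSet_Ioi (measure_ne_top _ _),
    measure_compl measurableSet_Ioi (measure_ne_top _ _), hIoi, huniv]

lemma rr_integral (a b : ℝ) (hab : a < b) (φ : ℝ → ℝ)
    (hφ : AEMeasurable φ (volume.restrict (Set.Ioo a b))) (f : ℝ → ℝ) (hf : Continuous f) :
    ∫ x in Set.Ioo a b, f (φ x) = ∫ x in Set.Ioo a b, f (decRearrange φ a b x) := by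
  have hg : AEMeasurable (decRearrange φ a b) (volume.restrict (Set.Ioo a b)) :=
    aemeasurable_restrict_of_antitoneOn measurableSet_Ioo (rr_anti a b hab φ hφ)
  rw [← integral_map hφ hf.aestronglyMeasurable, ← rr_map a b hab φ hφ,
    integral_map hg hf.aestronglyMeasurable]

lemma rr_integrable (a b : ℝ) (hab : a < b) (φ : ℝ → ℝ)
    (hφ : AEMeasurable φ (volume.restrict (Set.Ioo a b))) (f : ℝ → ℝ) (hf : Continuous f)
    (hi : IntegrableOn (fun x => f (φ x)) (Set.Ioo a b)) :
    IntegrableOn (fun x => f (decRearrange φ a b x)) (Set.Ioo a b) := by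
  have hg : AEMeasurable (decRearrange φ a b) (volume.restrict (Set.Ioo a b)) :=
    aemeasurable_restrict_of_antitoneOn measurableSet_Ioo (rr_anti a b hab φ hφ)
  have h1 := (integrable_map_measure hf.aestronglyMeasurable hφ).2 hi
  rw [← rr_map a b hab φ hφ] at h1
  exact (integrable_map_measure hf.aestronglyMeasurable hg).1 h1

/-- Expansion of a quadratic integral. -/
lemma rr_sq_expand (c d κ : ℝ) (f : ℝ → ℝ) (hf : IntervalIntegrable f volume c d)
    (hf2 : IntervalIntegrable (fun x => f x ^ 2) volume c d) :
    ∫ x in c..d, (f x - κ) ^ 2 =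
      (∫ x in c..d, f x ^ 2) - 2 * κ * (∫ x in c..d, f x) + κ ^ 2 * (d - c) := by
  have e : ∀ x, (f x - κ) ^ 2 = f x ^ 2 - 2 * κ * f x + κ ^ 2 := fun x => by ring
  simp only [e]
  rw [intervalIntegral.integral_add (hf2.sub (hf.const_mul _)) (by simp),
    intervalIntegral.integral_sub hf2 (hf.const_mul _), intervalIntegral.integral_const_mul,
    intervalIntegral.integral_const, smul_eq_mul]
  ring

lemma rr_sq_integrable (c d κ : ℝ) (f : ℝ → ℝ) (hf : IntervalIntegrable f volume c d)
    (hf2 : IntervalIntegrable (fun x => f x ^ 2) volume c d) :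
    IntervalIntegrable (fun x => (f x - κ) ^ 2) volume c d := by
  have e : (fun x => (f x - κ) ^ 2) = fun x => f x ^ 2 - 2 * κ * f x + κ ^ 2 := by
    ext x
    ring
  rw [e]
  exact (hf2.sub (hf.const_mul _)).add (by simp)

/-- The main estimate for intervals compactly contained in `(a, b)`. -/
lemma rr_main (a b : ℝ) (hab : a < b) (φ : ℝ → ℝ)
    (hφint : IntegrableOn φ (Set.Icc a b))
    (hφ2int : IntegrableOn (fun x => φ x ^ 2) (Set.Icc a b))
    (c d V' : ℝ) (hac : a < c) (hcd : c < d) (hdb : d < b) (hV'0 : 0 ≤ V')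
    (hnorm : ∀ c' d' : ℝ, a ≤ c' → c' < d' → d' ≤ b → d' - c' ≤ d - c →
      intervalAvg (fun x => φ x ^ 2) c' d' - (intervalAvg φ c' d') ^ 2 ≤ V') :
    intervalAvg (fun x => (decRearrange φ a b x) ^ 2) c d -
          (intervalAvg (fun x => decRearrange φ a b x) c d) ^ 2 ≤ V' := by
  have hφm : AEMeasurable φ (volume.restrict (Set.Ioo a b)) :=
    (hφint.mono_set Set.Ioo_subset_Icc_self).aestronglyMeasurable.aemeasurable
  have hIoo : ∀ (f : ℝ → ℝ) (α β : ℝ), α ≤ β → ∫ x in Set.Ioo α β, f x = ∫ x in α..β, f x :=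
    fun f α β hαβ => by rw [intervalIntegral.integral_of_le hαβ, integral_Ioc_eq_integral_Ioo]
  set g := decRearrange φ a b with hg
  have hanti : AntitoneOn g (Set.Ioo a b) := rr_anti a b hab φ hφm
  have hcI : c ∈ Set.Ioo a b := ⟨hac, hcd.trans hdb⟩
  have hdI : d ∈ Set.Ioo a b := ⟨hac.trans hcd, hdb⟩
  set t := intervalAvg g c d with ht
  have hdc : 0 < d - c := sub_pos.2 hcd
  have hgsub : IntervalIntegrable g volume c d ∧
      IntervalIntegrable (fun x => g x ^ 2) volume c d := by
    have h1 := rr_integrable a b hab φ hφm id continuous_id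
      (hφint.mono_set Set.Ioo_subset_Icc_self)
    have h2 := rr_integrable a b hab φ hφm (fun x => x ^ 2) (continuous_pow 2)
      (hφ2int.mono_set Set.Ioo_subset_Icc_self)
    have hs : Set.uIcc c d ⊆ Set.Ioo a b := Set.ordConnected_Ioo.uIcc_subset hcI hdI
    exact ⟨(h1.mono_set hs).intervalIntegrable, (h2.mono_set hs).intervalIntegrable⟩
  obtain ⟨hgi, hg2i⟩ := hgsub
  have hgt : ∫ x in c..d, g x = t * (d - c) := by
    rw [ht, intervalAvg]
    field_simp
  set V := intervalAvg (fun x => g x ^ 2) c d - t ^ 2 with hV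
  have hg2t : ∫ x in c..d, g x ^ 2 = (V + t ^ 2) * (d - c) := by
    rw [hV, intervalAvg]
    field_simp
    ring
  -- clamping
  set M := g c with hM
  set m := g d with hm
  have hmM : m ≤ M := hanti hcI hdI hcd.le
  have hmt : m ≤ t := by
    have : ∫ x in c..d, m ≤ ∫ x in c..d, g x :=
      intervalIntegral.integral_mono_on hcd.le (by simp) hgi fun x hx =>
        hanti ⟨hac.trans_le hx.1, hx.2.trans_lt hdb⟩ hdI hx.2
    rw [hgt, intervalIntegral.integral_const, smul_eq_mul] at this
    nlinarith
  have htM : t ≤ M := by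
    have : ∫ x in c..d, g x ≤ ∫ x in c..d, M :=
      intervalIntegral.integral_mono_on hcd.le hgi (by simp) fun x hx =>
        hanti hcI ⟨hac.trans_le hx.1, hx.2.trans_lt hdb⟩ hx.1
    rw [hgt, intervalIntegral.integral_const, smul_eq_mul] at this
    nlinarith
  set cl : ℝ → ℝ := fun x => max m (min x M) with hcl
  have hclc : Continuous cl := continuous_const.max (continuous_id.min continuous_const)
  have hclm : ∀ x, m ≤ cl x := fun x => le_max_left _ _
  have hclM : ∀ x, cl x ≤ M := fun x => max_le hmM (min_le_right _ _)
  have hcllip : ∀ x y, (cl x - cl y) ^ 2 ≤ (x - y) ^ 2 := by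
    intro x y
    rw [sq_le_sq]
    calc |cl x - cl y| = |max (min x M) m - max (min y M) m| := by
            simp only [hcl, max_comm m]
      _ ≤ |min x M - min y M| := abs_max_sub_max_le_abs _ _ _
      _ ≤ |x - y| := by
            have := abs_min_sub_min_le_max x M y M
            simpa using this
  -- integrals of functions of the clamped function
  have hsplit : ∀ f : ℝ → ℝ, Continuous f → ∫ x in Set.Ioo a b, f (cl (φ x)) =
      (c - a) * f M + (∫ x in c..d, f (g x)) + (b - d) * f m := by
    intro f hf
    have hfc : Continuous (fun x => f (cl x)) := hf.comp hclc
    rw [rr_integral a b hab φ hφm (fun x => f (cl x)) hfc, hIoo _ _ _ hab.le]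
    have hinner : IntegrableOn (fun x => f (cl (g x))) (Set.Ioo a b) := by
      obtain ⟨K, hK⟩ := (isCompact_Icc (a := m) (b := M)).exists_bound_of_continuousOn
        hf.continuousOn
      have hgm : AEMeasurable g (volume.restrict (Set.Ioo a b)) :=
        aemeasurable_restrict_of_antitoneOn measurableSet_Ioo hanti
      have hfm : IsFiniteMeasure (volume.restrict (Set.Ioo a b)) := ⟨by simp⟩
      refine Integrable.of_bound (hfc.comp_aestronglyMeasurable hgm.aestronglyMeasurable) K ?_
      exact ae_of_all _ fun x => hK _ ⟨hclm _, hclM _⟩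
    have hii : ∀ α β, a ≤ α → α ≤ β → β ≤ b →
        IntervalIntegrable (fun x => f (cl (g x))) volume α β := by
      intro α β h1 h2 h3
      rw [intervalIntegrable_iff_integrableOn_Ioo_of_le h2]
      exact hinner.mono_set (Set.Ioo_subset_Ioo h1 h3)
    rw [← intervalIntegral.integral_add_adjacent_intervals (b := d)
        (hii a d le_rfl (hac.trans hcd).le hdb.le) (hii d b (hac.trans hcd).le hdb.le le_rfl),
      ← intervalIntegral.integral_add_adjacent_intervals (b := c)
        (hii a c le_rfl hac.le (hcd.trans hdb).le) (hii c d hac.le hcd.le hdb.le)]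
    have e1 : ∫ x in a..c, f (cl (g x)) = (c - a) * f M := by
      rw [← hIoo _ _ _ hac.le, setIntegral_congr_fun (g := fun _ => f M) measurableSet_Ioo,
        setIntegral_const, Real.volume_real_Ioo_of_le hac.le, smul_eq_mul]
      intro x hx
      have : M ≤ g x := hanti ⟨hx.1, hx.2.trans hcI.2⟩ hcI hx.2.le
      simp only [hcl, min_eq_right this, max_eq_right hmM]
    have e2 : ∫ x in c..d, f (cl (g x)) = ∫ x in c..d, f (g x) := by
      rw [← hIoo _ _ _ hcd.le, ← hIoo _ _ _ hcd.le]
      apply setIntegral_congr_fun measurableSet_Ioo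
      intro x hx
      have hxI : x ∈ Set.Ioo a b := ⟨hac.trans hx.1, hx.2.trans hdb⟩
      have h1 : g x ≤ M := hanti hcI hxI hx.1.le
      have h2 : m ≤ g x := hanti hxI hdI hx.2.le
      simp only [hcl, min_eq_left h1, max_eq_right h2]
    have e3 : ∫ x in d..b, f (cl (g x)) = (b - d) * f m := by
      rw [← hIoo _ _ _ hdb.le, setIntegral_congr_fun (g := fun _ => f m) measurableSet_Ioo,
        setIntegral_const, Real.volume_real_Ioo_of_le hdb.le, smul_eq_mul]
      intro x hx
      have : g x ≤ m := hanti hdI ⟨hdI.1.trans hx.1, hx.2⟩ hx.1.le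
      simp only [hcl, min_eq_left (this.trans hmM), max_eq_left this]
    rw [e1, e2, e3]
  -- the truncated function
  have hclφ : ∀ f : ℝ → ℝ, Continuous f → IntegrableOn (fun x => f (cl (φ x))) (Set.Ioo a b) := by
    intro f hf
    have hfc : Continuous (fun x => f (cl x)) := hf.comp hclc
    obtain ⟨K, hK⟩ := (isCompact_Icc (a := m) (b := M)).exists_bound_of_continuousOn
      hf.continuousOn
    have hfm : IsFiniteMeasure (volume.restrict (Set.Ioo a b)) := ⟨by simp⟩
    refine Integrable.of_bound (hfc.comp_aestronglyMeasurable hφm.aestronglyMeasurable) K ?_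
    exact ae_of_all _ fun x => hK _ ⟨hclm _, hclM _⟩
  set ψ : ℝ → ℝ := Set.indicator (Set.Ioo a b) (fun x => cl (φ x) - t) with hψdef
  have hψin : ∀ x ∈ Set.Ioo a b, ψ x = cl (φ x) - t := fun x hx => Set.indicator_of_mem hx _
  have hψ : Integrable ψ :=
    (integrable_indicator_iff measurableSet_Ioo).2
      (hclφ (fun x => x - t) (continuous_id.sub continuous_const))
  have hψ2 : Integrable (fun x => ψ x ^ 2) := by
    have : (fun x => ψ x ^ 2) = Set.indicator (Set.Ioo a b) (fun x => (cl (φ x) - t) ^ 2) := by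
      ext x
      by_cases hx : x ∈ Set.Ioo a b
      · rw [hψin x hx, Set.indicator_of_mem hx]
      · rw [hψdef, Set.indicator_of_notMem hx, Set.indicator_of_notMem hx]
        norm_num
    rw [this]
    exact (integrable_indicator_iff measurableSet_Ioo).2
      (hclφ (fun x => (x - t) ^ 2) ((continuous_id.sub continuous_const).pow 2))
  have hVK : ∀ c' d', a ≤ c' → c' < d' → d' ≤ b → d' - c' ≤ d - c → ∫ s in c'..d', ψ s = 0 →
      ∫ s in c'..d', ψ s ^ 2 ≤ V' * (d' - c') := by
    intro c' d' h1 h2 h3 h4 h0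
    have hl : 0 < d' - c' := sub_pos.2 h2
    have hsub : Set.Ioo c' d' ⊆ Set.Ioo a b := Set.Ioo_subset_Ioo h1 h3
    have hsub' : Set.Ioo c' d' ⊆ Set.Icc a b := hsub.trans Set.Ioo_subset_Icc_self
    have j1 : IntervalIntegrable φ volume c' d' :=
      (intervalIntegrable_iff_integrableOn_Ioo_of_le h2.le).2 (hφint.mono_set hsub')
    have j2 : IntervalIntegrable (fun x => φ x ^ 2) volume c' d' :=
      (intervalIntegrable_iff_integrableOn_Ioo_of_le h2.le).2 (hφ2int.mono_set hsub')
    have k1 : IntervalIntegrable (fun x => cl (φ x)) volume c' d' :=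
      (intervalIntegrable_iff_integrableOn_Ioo_of_le h2.le).2
        ((hclφ id continuous_id).mono_set hsub)
    have k2 : IntervalIntegrable (fun x => cl (φ x) ^ 2) volume c' d' :=
      (intervalIntegrable_iff_integrableOn_Ioo_of_le h2.le).2
        ((hclφ (fun x => x ^ 2) (continuous_pow 2)).mono_set hsub)
    set s := intervalAvg φ c' d' with hs
    have hsi : ∫ x in c'..d', φ x = s * (d' - c') := by
      rw [hs, intervalAvg]
      field_simp
    have hn := hnorm c' d' h1 h2 h3 h4
    have hn2 : ∫ x in c'..d', φ x ^ 2 ≤ (V' + s ^ 2) * (d' - c') := by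
      have : intervalAvg (fun x => φ x ^ 2) c' d' ≤ V' + s ^ 2 := by linarith
      rw [intervalAvg, inv_mul_le_iff₀ hl] at this
      linarith
    have q1 : ∫ x in c'..d', ψ x = ∫ x in c'..d', (cl (φ x) - t) := by
      rw [← hIoo _ _ _ h2.le, ← hIoo _ _ _ h2.le]
      exact setIntegral_congr_fun measurableSet_Ioo fun x hx => hψin x (hsub hx)
    have q2 : ∫ x in c'..d', ψ x ^ 2 = ∫ x in c'..d', (cl (φ x) - t) ^ 2 := by
      rw [← hIoo _ _ _ h2.le, ← hIoo _ _ _ h2.le]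
      refine setIntegral_congr_fun measurableSet_Ioo fun x hx => ?_
      simp only [hψin x (hsub hx)]
    rw [q1, intervalIntegral.integral_sub k1 (by simp), intervalIntegral.integral_const,
      smul_eq_mul] at h0
    have r1 := rr_sq_expand c' d' t (fun x => cl (φ x)) k1 k2
    have r2 := rr_sq_expand c' d' (cl s) (fun x => cl (φ x)) k1 k2
    have r3 := rr_sq_expand c' d' s φ j1 j2
    have r4 : ∫ x in c'..d', (cl (φ x) - cl s) ^ 2 ≤ ∫ x in c'..d', (φ x - s) ^ 2 :=
      intervalIntegral.integral_mono_on h2.le (rr_sq_integrable c' d' (cl s) _ k1 k2)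
        (rr_sq_integrable c' d' s φ j1 j2) fun x _ => hcllip _ _
    have h0' : ∫ x in c'..d', cl (φ x) = t * (d' - c') := by linarith
    rw [h0'] at r1 r2
    rw [hsi] at r3
    rw [q2]
    nlinarith [mul_nonneg (sq_nonneg (t - cl s)) hl.le]
  obtain ⟨E, E1, E2, E3, E4, E5⟩ := rr_cover a b (d - c) V' hab hdc ψ hψ hψ2 hVK
  refine rr_compare a b (d - c) (c - a) (b - d) (m - t) (M - t) V V' hab hdc (by linarith)
    (by linarith) (by ring) (by linarith) (by linarith) hV'0 ψ hψ hψ2 ?_ ?_ ?_ E E1 E2 E3 E4 E5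
  · intro x hx
    rw [hψin x hx]
    exact ⟨by linarith [hclm (φ x)], by linarith [hclM (φ x)]⟩
  · rw [setIntegral_congr_fun measurableSet_Ioo hψin,
      hsplit (fun x => x - t) (continuous_id.sub continuous_const),
      intervalIntegral.integral_sub hgi (by simp), hgt, intervalIntegral.integral_const,
      smul_eq_mul]
    ring
  · have : ∫ x in Set.Ioo a b, ψ x ^ 2 = ∫ x in Set.Ioo a b, (cl (φ x) - t) ^ 2 := by
      refine setIntegral_congr_fun measurableSet_Ioo fun x hx => ?_
      simp only [hψin x hx]
    rw [this, hsplit (fun x => (x - t) ^ 2) ((continuous_id.sub continuous_const).pow 2),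
      rr_sq_expand c d t g hgi hg2i, hgt, hg2t]
    ring

/-- (Main theorem.) Let `ξ` be a modulus on `[0,|I|]` and `φ ∈ Ξ_ξ(I)`. Then
the decreasing rearrangement `φ*` also lies in `Ξ_ξ(I)` and `‖φ*‖ ≤ ‖φ‖`: for every `C > 0`,
if `⟨φ²⟩_J − ⟨φ⟩_J² ≤ C²ξ²(|J|)` for all subintervals `J ⊂ I`, then the same holds for `φ*`. -/
theorem statement16 (a b : ℝ) (hab : a < b) (ξ : ℝ → ℝ)
    (hcont : ContinuousOn ξ (Set.Icc 0 (b - a)))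
    (hmono : MonotoneOn ξ (Set.Icc 0 (b - a)))
    (hξ0 : ξ 0 = 0)
    (φ : ℝ → ℝ)
    (hφint : IntegrableOn φ (Set.Icc a b))
    (hφ2int : IntegrableOn (fun x => φ x ^ 2) (Set.Icc a b))
    (C : ℝ) (hC : 0 < C)
    (hnorm : ∀ c d : ℝ, a ≤ c → c < d → d ≤ b →
      intervalAvg (fun x => φ x ^ 2) c d - (intervalAvg φ c d) ^ 2 ≤ C ^ 2 * ξ (d - c) ^ 2) :
    ∀ c d : ℝ, a ≤ c → c < d → d ≤ b →
      intervalAvg (fun x => (decRearrange φ a b x) ^ 2) c d -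
          (intervalAvg (fun x => decRearrange φ a b x) c d) ^ 2 ≤
        C ^ 2 * ξ (d - c) ^ 2 := by
  have hφm : AEMeasurable φ (volume.restrict (Set.Ioo a b)) :=
    (hφint.mono_set Set.Ioo_subset_Icc_self).aestronglyMeasurable.aemeasurable
  intro c d hac hcd hdb
  set g := decRearrange φ a b with hg
  have hdc : 0 < d - c := sub_pos.2 hcd
  have hξnn : ∀ x, 0 ≤ x → x ≤ b - a → 0 ≤ ξ x := by
    intro x h1 h2
    have := hmono ⟨le_rfl, by linarith⟩ ⟨h1, h2⟩ h1
    rwa [hξ0] at this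
  -- interior intervals
  have hinner : ∀ c' d', c < c' → c' < d' → d' < d →
      intervalAvg (fun x => g x ^ 2) c' d' - (intervalAvg (fun x => g x) c' d') ^ 2 ≤
        C ^ 2 * ξ (d - c) ^ 2 := by
    intro c' d' h1 h2 h3
    refine rr_main a b hab φ hφint hφ2int c' d' _ (by linarith) h2 (by linarith) (by positivity) ?_
    intro c'' d'' k1 k2 k3 k4
    refine (hnorm c'' d'' k1 k2 k3).trans ?_
    have h5 := hξnn (d'' - c'') (by linarith) (by linarith)
    have h6 := hmono (a := d'' - c'') (b := d - c) ⟨by linarith, by linarith⟩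
      ⟨by linarith, by linarith⟩ (by linarith)
    gcongr
  -- limit
  have i1 : IntervalIntegrable g volume a b :=
    (intervalIntegrable_iff_integrableOn_Ioo_of_le hab.le).2 (rr_integrable a b hab φ hφm id
      continuous_id (hφint.mono_set Set.Ioo_subset_Icc_self))
  have i2 : IntervalIntegrable (fun x => g x ^ 2) volume a b :=
    (intervalIntegrable_iff_integrableOn_Ioo_of_le hab.le).2 (rr_integrable a b hab φ hφm
      (fun x => x ^ 2) (continuous_pow 2) (hφ2int.mono_set Set.Ioo_subset_Icc_self))
  set cs : ℝ → ℝ := fun ε => c + ε with hcs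
  set ds : ℝ → ℝ := fun ε => d - ε with hds
  have hlim : ∀ f : ℝ → ℝ, IntervalIntegrable f volume a b →
      Filter.Tendsto (fun ε => intervalAvg f (cs ε) (ds ε)) (nhdsWithin 0 (Set.Ioi 0))
        (nhds (intervalAvg f c d)) := by
    intro f hf
    have hFc : ContinuousOn (fun x => ∫ s in a..x, f s) (Set.Icc a b) := by
      have := intervalIntegral.continuousOn_primitive_interval' hf Set.left_mem_uIcc
      rwa [Set.uIcc_of_le hab.le] at this
    have tc : Filter.Tendsto cs (nhdsWithin 0 (Set.Ioi 0)) (nhds c) := by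
      have : Continuous cs := by fun_prop
      simpa [hcs] using (this.tendsto 0).mono_left nhdsWithin_le_nhds
    have td : Filter.Tendsto ds (nhdsWithin 0 (Set.Ioi 0)) (nhds d) := by
      have : Continuous ds := by fun_prop
      simpa [hds] using (this.tendsto 0).mono_left nhdsWithin_le_nhds
    have hev : ∀ᶠ ε in nhdsWithin (0:ℝ) (Set.Ioi 0), 0 < ε ∧ ε < (d - c) / 2 := by
      filter_upwards [self_mem_nhdsWithin, mem_nhdsWithin_of_mem_nhds
        (Iio_mem_nhds (show (0:ℝ) < (d - c) / 2 by linarith))] with ε h1 h2 using ⟨h1, h2⟩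
    have tc' : Filter.Tendsto cs (nhdsWithin 0 (Set.Ioi 0)) (nhdsWithin c (Set.Icc a b)) :=
      tendsto_nhdsWithin_iff.2 ⟨tc, by
        filter_upwards [hev] with ε hε
        exact ⟨by simp only [hcs]; linarith, by simp only [hcs]; linarith⟩⟩
    have td' : Filter.Tendsto ds (nhdsWithin 0 (Set.Ioi 0)) (nhdsWithin d (Set.Icc a b)) :=
      tendsto_nhdsWithin_iff.2 ⟨td, by
        filter_upwards [hev] with ε hε
        exact ⟨by simp only [hds]; linarith, by simp only [hds]; linarith⟩⟩
    have hsubi : ∀ x ∈ Set.Icc a b, IntervalIntegrable f volume a x := fun x hx =>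
      hf.mono_set (by
        rw [Set.uIcc_of_le hab.le, Set.uIcc_of_le hx.1]
        exact Set.Icc_subset_Icc le_rfl hx.2)
    have hrep : ∀ x ∈ Set.Icc a b, ∀ y ∈ Set.Icc a b, intervalAvg f x y =
        (y - x)⁻¹ * ((∫ s in a..y, f s) - ∫ s in a..x, f s) := fun x hx y hy => by
      rw [intervalAvg, intervalIntegral.integral_interval_sub_left (hsubi y hy) (hsubi x hx)]
    have hcI : c ∈ Set.Icc a b := ⟨hac, by linarith⟩
    have hdI : d ∈ Set.Icc a b := ⟨by linarith, hdb⟩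
    rw [hrep c hcI d hdI]
    have T := ((td.sub tc).inv₀ hdc.ne').mul
      (((hFc d hdI).tendsto.comp td').sub ((hFc c hcI).tendsto.comp tc'))
    refine T.congr' ?_
    filter_upwards [hev] with ε hε
    have g1 : cs ε ∈ Set.Icc a b :=
      ⟨by simp only [hcs]; linarith, by simp only [hcs]; linarith⟩
    have g2 : ds ε ∈ Set.Icc a b :=
      ⟨by simp only [hds]; linarith, by simp only [hds]; linarith⟩
    rw [hrep _ g1 _ g2]
    rfl
  refine le_of_tendsto ((hlim _ i2).sub ((hlim _ i1).pow 2)) ?_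
  filter_upwards [self_mem_nhdsWithin, mem_nhdsWithin_of_mem_nhds
    (Iio_mem_nhds (show (0:ℝ) < (d - c) / 2 by linarith))] with ε h1 h2
  have h1' : 0 < ε := h1
  have h2' : ε < (d - c) / 2 := h2
  exact hinner (cs ε) (ds ε) (by simp only [hcs]; linarith)
    (by simp only [hcs, hds]; linarith) (by simp only [hds]; linarith)
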